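/- Let K be a separable metric space and let f, g : K → ℝ be bounded functions of finite Baire index. Let h be any of the functions f + g, f·g, max{f,g}, min{f,g}. Then h has finite Baire index and i(h) ≤ i(f) + i(g). -/

import Mathlib

open Filter Topology Set

noncomputable section

/-- A real-valued function is bounded. -/
def BddFun {X : Type*} (f : X → ℝ) : Prop := ∃ C, ∀ x, |f x| ≤ C

/-- `f ∈ DBSC(X)`: `f` is a difference of bounded lower semicontinuous functions. -/
def MemDBSC {X : Type*} [TopologicalSpace X] (f : X → ℝ) : Prop :=
  ∃ u v : X → ℝ, BddFun u ∧ BddFun v ∧ LowerSemicontinuous u ∧ LowerSemicontinuous v ∧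
    f = u - v

/-- The D-norm of `f`. -/
def DNorm {X : Type*} [TopologicalSpace X] (f : X → ℝ) : ℝ :=
  sInf {c | ∃ φ : ℕ → X → ℝ, (∀ j, Continuous (φ j)) ∧ (∀ x, Summable fun j => |φ j x|) ∧
    (∀ x, ∑' j, φ j x = f x) ∧ (∀ x, ∑' j, |φ j x| ≤ c)}

/-- The sup-norm of `f`. -/
def supNorm {X : Type*} (f : X → ℝ) : ℝ := ⨆ x, |f x|

/-- A simple D-function: a D-function taking finitely many values. -/
def SimpleD {X : Type*} [TopologicalSpace X] (f : X → ℝ) : Prop :=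
  MemDBSC f ∧ (Set.range f).Finite

/-- `f ∈ SD(X)`: `f` is a strong D-function. -/
def MemSD {X : Type*} [TopologicalSpace X] (f : X → ℝ) : Prop :=
  ∃ φ : ℕ → X → ℝ, (∀ n, SimpleD (φ n)) ∧
    Tendsto (fun n => DNorm (f - φ n)) atTop (𝓝 0)

/-- `f ∈ B_{1/2}(X)`: `f` is a uniform limit of D-functions. -/
def MemBHalf {X : Type*} [TopologicalSpace X] (f : X → ℝ) : Prop :=
  ∃ g : ℕ → X → ℝ, (∀ n, MemDBSC (g n)) ∧ TendstoUniformly g f atTop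

/-- The upper semicontinuous envelope `Uf`. -/
def uEnv {X : Type*} [TopologicalSpace X] (f : X → ℝ) (x : X) : ℝ :=
  sInf {c | ∃ V : Set X, IsOpen V ∧ x ∈ V ∧ sSup (f '' V) = c}

/-- The lower oscillation of `f` at `x`. -/
def losc {X : Type*} [TopologicalSpace X] (f : X → ℝ) (x : X) : ℝ :=
  sInf {c | ∃ V : Set X, IsOpen V ∧ x ∈ V ∧ sSup ((fun y => |f y - f x|) '' V) = c}

/-- The oscillation of `f`: `osc f = U (losc f)`. -/
def osc {X : Type*} [TopologicalSpace X] (f : X → ℝ) : X → ℝ := uEnv (losc f)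

/-- The oscillation sets `os_n(f, ε)`. -/
def osSet {X : Type*} [TopologicalSpace X] (f : X → ℝ) (ε : ℝ) : ℕ → Set X
  | 0 => Set.univ
  | n + 1 => {x | ∃ h : x ∈ osSet f ε n, ε ≤ osc ((osSet f ε n).restrict f) ⟨x, h⟩}

/-- The `ε`-oscillation index `i(f, ε) = sup {n : os_n(f,ε) ≠ ∅}`. -/
def oscIndex {X : Type*} [TopologicalSpace X] (f : X → ℝ) (ε : ℝ) : ℕ∞ :=
  ⨆ (m : ℕ) (_ : (osSet f ε m).Nonempty), (m : ℕ∞)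

/-- `f` has finite Baire index. -/
def FiniteBaireIndex {X : Type*} [TopologicalSpace X] (f : X → ℝ) : Prop :=
  ∃ n : ℕ, ∀ ε > 0, osSet f ε n = ∅

/-- The Baire index `i(f) = sup_{ε > 0} i(f, ε)`. -/
def baireIndex {X : Type*} [TopologicalSpace X] (f : X → ℝ) : ℕ∞ :=
  ⨆ (ε : ℝ) (_ : 0 < ε), oscIndex f ε

open scoped ENNReal

/-- The oscillation of `f` on `L` near `x` is less than `ε`, expressed with filters. -/
def OscLT {X : Type*} [TopologicalSpace X] (f : X → ℝ) (L : Set X) (ε : ℝ) (x : X) : Prop :=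
  ∃ ε' < ε, ∀ᶠ y in 𝓝[L] x, ∀ᶠ z in 𝓝[L] y, |f z - f y| ≤ ε'

theorem BddFun.domRestrict {X : Type*} {f : X → ℝ} (hf : BddFun f) (L : Set X) :
    BddFun (L.domRestrict f) := by
  obtain ⟨C, hC⟩ := hf
  exact ⟨C, fun x => hC x⟩

theorem BddFun.abs_sub_le {X : Type*} {f : X → ℝ} {C : ℝ} (hC : ∀ x, |f x| ≤ C) (x y : X) :
    |f y - f x| ≤ 2 * C := by
  have := abs_sub (f y) (f x)
  linarith [hC x, hC y]

section Oscillation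

variable {X : Type*} [TopologicalSpace X]

theorem uEnv_lt_iff {f : X → ℝ} (h0 : ∀ x, 0 ≤ f x) (hf : BddFun f) (x : X) (ε : ℝ) :
    uEnv f x < ε ↔ ∃ ε' < ε, ∀ᶠ y in 𝓝 x, f y ≤ ε' := by
  obtain ⟨C, hC⟩ := hf
  have hbdd (V : Set X) : BddAbove (f '' V) :=
    ⟨C, by rintro _ ⟨y, -, rfl⟩; exact (le_abs_self _).trans (hC y)⟩
  constructor
  · intro h
    have hne : {c | ∃ V : Set X, IsOpen V ∧ x ∈ V ∧ sSup (f '' V) = c}.Nonempty :=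
      ⟨_, univ, isOpen_univ, mem_univ x, rfl⟩
    obtain ⟨_, ⟨V, hV, hx, rfl⟩, hc⟩ := exists_lt_of_csInf_lt hne h
    refine ⟨_, hc, ?_⟩
    filter_upwards [hV.mem_nhds hx] with y hy
    exact le_csSup (hbdd V) (mem_image_of_mem f hy)
  · rintro ⟨ε', hε', h⟩
    obtain ⟨V, hVs, hV, hx⟩ := eventually_nhds_iff.mp h
    refine lt_of_le_of_lt ?_ hε'
    have hmem : sSup (f '' V) ∈ {c | ∃ V : Set X, IsOpen V ∧ x ∈ V ∧ sSup (f '' V) = c} :=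
      ⟨V, hV, hx, rfl⟩
    refine (csInf_le ?_ hmem).trans (csSup_le ⟨_, mem_image_of_mem f hx⟩ ?_)
    · refine ⟨0, ?_⟩
      rintro _ ⟨W, -, -, rfl⟩
      exact Real.sSup_nonneg (by rintro _ ⟨y, -, rfl⟩; exact h0 y)
    · rintro _ ⟨y, hy, rfl⟩
      exact hVs y hy

theorem losc_eq_uEnv (f : X → ℝ) (x : X) : losc f x = uEnv (fun y => |f y - f x|) x := rfl

theorem losc_lt_iff {f : X → ℝ} (hf : BddFun f) (x : X) (ε : ℝ) :
    losc f x < ε ↔ ∃ ε' < ε, ∀ᶠ y in 𝓝 x, |f y - f x| ≤ ε' := by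
  obtain ⟨C, hC⟩ := hf
  rw [losc_eq_uEnv]
  refine uEnv_lt_iff (fun y => abs_nonneg _) ⟨2 * C, fun y => ?_⟩ x ε
  rw [abs_abs]
  exact BddFun.abs_sub_le hC x y

theorem losc_nonneg {f : X → ℝ} (hf : BddFun f) (x : X) : 0 ≤ losc f x := by
  by_contra! h
  obtain ⟨ε', hε', hy⟩ := (losc_lt_iff hf x 0).mp h
  linarith [hy.self_of_nhds, abs_nonneg (f x - f x)]

theorem BddFun.losc {f : X → ℝ} (hf : BddFun f) : BddFun (losc f) := by
  have hf' := hf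
  obtain ⟨C, hC⟩ := hf'
  refine ⟨2 * C + 1, fun x => ?_⟩
  rw [abs_of_nonneg (losc_nonneg hf x)]
  exact ((losc_lt_iff hf x _).mpr ⟨2 * C, by linarith,
    Eventually.of_forall fun y => BddFun.abs_sub_le hC x y⟩).le

theorem osc_lt_iff {f : X → ℝ} (hf : BddFun f) (x : X) (ε : ℝ) :
    osc f x < ε ↔ ∃ ε' < ε, ∀ᶠ y in 𝓝 x, ∀ᶠ z in 𝓝 y, |f z - f y| ≤ ε' := by
  rw [osc, uEnv_lt_iff (losc_nonneg hf) hf.losc]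
  constructor
  · rintro ⟨ε', hε', h⟩
    obtain ⟨δ, hδ, hδε⟩ := exists_between hε'
    refine ⟨δ, hδε, h.mono fun y hy => ?_⟩
    obtain ⟨η, hη, hz⟩ := (losc_lt_iff hf y δ).mp (hy.trans_lt hδ)
    exact hz.mono fun z hz => hz.trans hη.le
  · rintro ⟨ε', hε', h⟩
    refine ⟨ε', hε', h.mono fun y hy => le_of_forall_gt fun δ hδ => ?_⟩
    exact (losc_lt_iff hf y δ).mpr ⟨ε', hδ, hy⟩

theorem osc_restrict_lt_iff {f : X → ℝ} (hf : BddFun f) (L : Set X) (x : L) (ε : ℝ) :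
    osc (L.domRestrict f) x < ε ↔ OscLT f L ε x := by
  rw [osc_lt_iff (hf.domRestrict L), OscLT]
  simp only [nhdsWithin_eq_map_subtype_coe x.2, eventually_map]
  refine exists_congr fun ε' => and_congr_right fun _ => eventually_congr ?_
  refine Eventually.of_forall fun y => ?_
  simp only [nhdsWithin_eq_map_subtype_coe y.2, eventually_map]
  rfl

theorem mem_osSet_succ_iff {f : X → ℝ} (hf : BddFun f) (ε : ℝ) (n : ℕ) (x : X) :
    x ∈ osSet f ε (n + 1) ↔ x ∈ osSet f ε n ∧ ¬ OscLT f (osSet f ε n) ε x := by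
  constructor
  · rintro ⟨h, hx⟩
    exact ⟨h, fun H => hx.not_gt ((osc_restrict_lt_iff hf _ ⟨x, h⟩ ε).mpr H)⟩
  · rintro ⟨h, hx⟩
    exact ⟨h, not_lt.mp fun H => hx ((osc_restrict_lt_iff hf _ ⟨x, h⟩ ε).mp H)⟩

theorem osSet_antitone (f : X → ℝ) (ε : ℝ) : Antitone (osSet f ε) :=
  antitone_nat_of_succ_le fun _ _ hx => hx.1

theorem isClosed_osSet {f : X → ℝ} (hf : BddFun f) (ε : ℝ) (n : ℕ) :
    IsClosed (osSet f ε n) := by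
  induction n with
  | zero => exact isClosed_univ
  | succ n ih =>
    rw [← isOpen_compl_iff, isOpen_iff_mem_nhds]
    intro x hx
    have key : ∀ᶠ y in 𝓝[osSet f ε n] x, OscLT f (osSet f ε n) ε y := by
      by_cases hxn : x ∈ osSet f ε n
      · have : OscLT f (osSet f ε n) ε x := by
          by_contra H
          exact hx ((mem_osSet_succ_iff hf ε n x).mpr ⟨hxn, H⟩)
        obtain ⟨ε', hε', h⟩ := this
        exact (eventually_eventually_nhdsWithin.mpr h).mono fun y hy => ⟨ε', hε', hy⟩
      · rw [notMem_closure_iff_nhdsWithin_eq_bot.mp (by rwa [ih.closure_eq])]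
        exact eventually_bot
    filter_upwards [eventually_nhdsWithin_iff.mp key] with y hy hmem
    obtain ⟨h1, h2⟩ := (mem_osSet_succ_iff hf ε n y).mp hmem
    exact h2 (hy h1)

theorem OscLT.mono_of_eventually {f : X → ℝ} {L M : Set X} {ε : ℝ} {x : X}
    (h : OscLT f M ε x) (hLM : ∀ᶠ y in 𝓝 x, y ∈ L → y ∈ M) : OscLT f L ε x := by
  obtain ⟨ε', hε', h⟩ := h
  have hle {y : X} (hy : ∀ᶠ z in 𝓝 y, z ∈ L → z ∈ M) : 𝓝[L] y ≤ 𝓝[M] y :=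
    nhdsWithin_le_iff.mpr (eventually_nhdsWithin_iff.mpr hy)
  refine ⟨ε', hε', ?_⟩
  filter_upwards [hle hLM h, nhdsWithin_le_nhds (eventually_eventually_nhds.mpr hLM)] with y hy hy'
  exact hle hy' hy

theorem OscLT.combination {f g h : X → ℝ} {L : Set X} {C δ : ℝ} {x : X} (hC : 0 < C)
    (hh : ∀ y z, |h z - h y| ≤ C * (|f z - f y| + |g z - g y|))
    (hf : OscLT f L δ x) (hg : OscLT g L δ x) : OscLT h L (2 * C * δ) x := by
  obtain ⟨a, ha, hf⟩ := hf
  obtain ⟨b, hb, hg⟩ := hg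
  refine ⟨C * (a + b), by nlinarith, ?_⟩
  filter_upwards [hf, hg] with y hfy hgy
  filter_upwards [hfy, hgy] with z hfz hgz
  exact (hh y z).trans (mul_le_mul_of_nonneg_left (add_le_add hfz hgz) hC.le)

/-- The oscillation sets of a combination `h` of `f` and `g` are covered by the intersections of
oscillation sets of `f` and `g` of complementary orders. -/
theorem exists_mem_osSet_of_mem_osSet_combination {f g h : X → ℝ} {C δ : ℝ}
    (hbf : BddFun f) (hbg : BddFun g) (hbh : BddFun h) (hC : 0 < C)
    (hh : ∀ y z, |h z - h y| ≤ C * (|f z - f y| + |g z - g y|)) (k : ℕ) :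
    ∀ x ∈ osSet h (2 * C * δ) k, ∃ i j, i + j = k ∧ x ∈ osSet f δ i ∧ x ∈ osSet g δ j := by
  induction k with
  | zero => exact fun x _ => ⟨0, 0, rfl, mem_univ x, mem_univ x⟩
  | succ k ih =>
    intro x hx
    obtain ⟨hxk, hosc⟩ := (mem_osSet_succ_iff hbh _ k x).mp hx
    obtain ⟨i, j, hij, hfi, hgj⟩ := ih x hxk
    by_cases hfi' : x ∈ osSet f δ (i + 1)
    · exact ⟨i + 1, j, by omega, hfi', hgj⟩
    by_cases hgj' : x ∈ osSet g δ (j + 1)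
    · exact ⟨i, j + 1, by omega, hfi, hgj'⟩
    have hloc : ∀ᶠ y in 𝓝 x, y ∈ osSet h (2 * C * δ) k → y ∈ osSet f δ i ∩ osSet g δ j := by
      filter_upwards [(isClosed_osSet hbf δ (i + 1)).isOpen_compl.mem_nhds hfi',
        (isClosed_osSet hbg δ (j + 1)).isOpen_compl.mem_nhds hgj'] with y hyf hyg hy
      obtain ⟨a, b, hab, hya, hyb⟩ := ih y hy
      have ha : a ≤ i := by
        by_contra! H
        exact hyf (osSet_antitone f δ H hya)
      have hb : b ≤ j := by
        by_contra! H
        exact hyg (osSet_antitone g δ H hyb)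
      obtain rfl : a = i := by omega
      obtain rfl : b = j := by omega
      exact ⟨hya, hyb⟩
    have hf : OscLT f (osSet f δ i) δ x := by
      by_contra H
      exact hfi' ((mem_osSet_succ_iff hbf δ i x).mpr ⟨hfi, H⟩)
    have hg : OscLT g (osSet g δ j) δ x := by
      by_contra H
      exact hgj' ((mem_osSet_succ_iff hbg δ j x).mpr ⟨hgj, H⟩)
    exact absurd (OscLT.combination hC hh
      (hf.mono_of_eventually (hloc.mono fun y hy hyL => (hy hyL).1))
      (hg.mono_of_eventually (hloc.mono fun y hy hyL => (hy hyL).2))) hosc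

theorem le_baireIndex {f : X → ℝ} {ε : ℝ} (hε : 0 < ε) {n : ℕ} (hn : (osSet f ε n).Nonempty) :
    (n : ℕ∞) ≤ baireIndex f :=
  le_iSup₂_of_le ε hε (le_iSup₂_of_le n hn le_rfl)

theorem baireIndex_le_add_of_abs_sub_le {f g h : X → ℝ} {C : ℝ}
    (hbf : BddFun f) (hbg : BddFun g) (hf : FiniteBaireIndex f) (hg : FiniteBaireIndex g)
    (hC : 0 < C) (hh : ∀ y z, |h z - h y| ≤ C * (|f z - f y| + |g z - g y|)) :
    FiniteBaireIndex h ∧ baireIndex h ≤ baireIndex f + baireIndex g := by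
  have hbh : BddFun h := by
    rcases isEmpty_or_nonempty X with _ | ⟨⟨y⟩⟩
    · exact ⟨0, fun x => isEmptyElim x⟩
    obtain ⟨A, hA⟩ := hbf
    obtain ⟨B, hB⟩ := hbg
    refine ⟨|h y| + C * (2 * A + 2 * B), fun z => ?_⟩
    have h1 := (hh y z).trans (mul_le_mul_of_nonneg_left
      (add_le_add (BddFun.abs_sub_le hA y z) (BddFun.abs_sub_le hB y z)) hC.le)
    linarith [abs_sub_abs_le_abs_sub (h z) (h y)]
  have key {ε : ℝ} (hε : 0 < ε) : ∃ δ > 0, ∀ k, ∀ x ∈ osSet h ε k,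
      ∃ i j, i + j = k ∧ x ∈ osSet f δ i ∧ x ∈ osSet g δ j := by
    have heq : 2 * C * (ε / (2 * C)) = ε := by field_simp
    refine ⟨ε / (2 * C), by positivity, fun k x hx => ?_⟩
    rw [← heq] at hx
    exact exists_mem_osSet_of_mem_osSet_combination hbf hbg hbh hC hh k x hx
  constructor
  · obtain ⟨n, hn⟩ := hf
    obtain ⟨m, hm⟩ := hg
    refine ⟨n + m, fun ε hε => eq_empty_of_forall_notMem fun x hx => ?_⟩
    obtain ⟨δ, hδ, H⟩ := key hε
    obtain ⟨i, j, hij, hi, hj⟩ := H _ x hx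
    rcases (by omega : n ≤ i ∨ m ≤ j) with h1 | h1
    · simpa [hn δ hδ] using osSet_antitone f δ h1 hi
    · simpa [hm δ hδ] using osSet_antitone g δ h1 hj
  · refine iSup₂_le fun ε hε => iSup₂_le fun k ⟨x, hx⟩ => ?_
    obtain ⟨δ, hδ, H⟩ := key hε
    obtain ⟨i, j, rfl, hi, hj⟩ := H k x hx
    rw [Nat.cast_add]
    exact add_le_add (le_baireIndex hδ ⟨x, hi⟩) (le_baireIndex hδ ⟨x, hj⟩)

end Oscillation

/-- **Theorem 1.3.** The functions of finite Baire index form an algebra and a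
lattice, with `i(h) ≤ i(f) + i(g)` for `h` any of `f + g`, `f·g`, `f ∨ g`, `f ∧ g`. -/
theorem baireIndex_combination_le {K : Type*} [MetricSpace K]
    [TopologicalSpace.SeparableSpace K] (f g h : K → ℝ)
    (hbf : BddFun f) (hbg : BddFun g)
    (hf : FiniteBaireIndex f) (hg : FiniteBaireIndex g)
    (hh : h = f + g ∨ h = f * g ∨ h = (fun x => max (f x) (g x)) ∨
      h = (fun x => min (f x) (g x))) :
    FiniteBaireIndex h ∧ baireIndex h ≤ baireIndex f + baireIndex g := by
  have hle {a b c d u : ℝ} (hu : u ≤ max |a - b| |c - d|) : u ≤ 1 * (|a - b| + |c - d|) := by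
    rw [one_mul]
    exact hu.trans (max_le_add_of_nonneg (abs_nonneg _) (abs_nonneg _))
  rcases hh with rfl | rfl | rfl | rfl
  · refine baireIndex_le_add_of_abs_sub_le hbf hbg hf hg one_pos fun y z => ?_
    rw [one_mul, Pi.add_apply, Pi.add_apply, add_sub_add_comm]
    exact abs_add_le _ _
  · obtain ⟨A, hA⟩ := id hbf
    obtain ⟨B, hB⟩ := id hbg
    have hC : 0 < max A B ⊔ 1 := lt_max_of_lt_right one_pos
    refine baireIndex_le_add_of_abs_sub_le hbf hbg hf hg hC fun y z => ?_
    have heq : (f * g) z - (f * g) y = g y * (f z - f y) + f z * (g z - g y) := by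
      simp only [Pi.mul_apply]
      ring
    rw [heq, mul_add]
    refine (abs_add_le _ _).trans ?_
    rw [abs_mul, abs_mul]
    gcongr
    · exact (hB y).trans ((le_max_right A B).trans (le_max_left _ _))
    · exact (hA z).trans ((le_max_left A B).trans (le_max_left _ _))
  · exact baireIndex_le_add_of_abs_sub_le hbf hbg hf hg one_pos fun y z =>
      hle (abs_max_sub_max_le_max _ _ _ _)
  · exact baireIndex_le_add_of_abs_sub_le hbf hbg hf hg one_pos fun y z =>
      hle (abs_min_sub_min_le_max _ _ _ _)
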